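/- Let Ξ = (Ξ_1,…,Ξ_g) be a convexotonic g-tuple of g×g complex matrices. If Ξ is jointly nilpotent, then its order of nilpotence is at most g; that is, Ξ^α = 0 for every word α in g letters with |α| ≥ g. -/

import Mathlib

/-- The product of matrices from the tuple `Ξ` along the word `α` (empty word ↦ identity). -/
noncomputable def wordProd {g d : ℕ} (Ξ : Fin g → Matrix (Fin d) (Fin d) ℂ)
    (α : List (Fin g)) : Matrix (Fin d) (Fin d) ℂ :=
  (α.map Ξ).prod

/-- A `g`-tuple of `g × g` matrices is convexotonic if
`Ξ_k Ξ_j = Σ_s (Ξ_j)_{k,s} Ξ_s` for all `j, k`. -/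
def Convexotonic {g : ℕ} (Ξ : Fin g → Matrix (Fin g) (Fin g) ℂ) : Prop :=
  ∀ j k : Fin g, Ξ k * Ξ j = ∑ s : Fin g, (Ξ j) k s • Ξ s

/-- If a monotone self-map of the lattice of submodules of a finite-dimensional space has an
iterate sending `⊤` to `⊥`, then it does so after at most `finrank K V` steps. -/
theorem Submodule.iterate_finrank_top_eq_bot {K V : Type*} [Field K] [AddCommGroup V] [Module K V]
    [FiniteDimensional K V] {Φ : Submodule K V → Submodule K V} (hΦ : Monotone Φ) {N : ℕ}
    (hN : Φ^[N] ⊤ = ⊥) : Φ^[Module.finrank K V] ⊤ = ⊥ := by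
  have anti : Antitone fun n => Φ^[n] ⊤ := hΦ.antitone_iterate_of_map_le le_top
  have key : ∀ n, Φ^[n] ⊤ = ⊥ ∨
      n + Module.finrank K (Φ^[n] ⊤ : Submodule K V) ≤ Module.finrank K V := by
    intro n
    induction n with
    | zero => exact .inr ((Nat.zero_add _).trans_le (Submodule.finrank_le _))
    | succ n ih =>
      by_cases h : Φ^[n + 1] ⊤ = Φ^[n] ⊤
      · left
        have hfix : Function.IsFixedPt Φ (Φ^[n] ⊤) := by
          rwa [Function.iterate_succ_apply'] at h
        have hle : Φ^[N + n] ⊤ ≤ Φ^[N] ⊤ := anti (Nat.le_add_right N n)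
        rw [Function.iterate_add_apply, (hfix.iterate N).eq, hN, le_bot_iff] at hle
        rw [h, hle]
      · have hlt : Φ^[n + 1] ⊤ < Φ^[n] ⊤ := lt_of_le_of_ne (anti n.le_succ) h
        rcases ih with ih | ih
        · exact absurd (ih ▸ hlt) not_lt_bot
        · right
          have := Submodule.finrank_lt_finrank_of_lt hlt
          omega
  rcases key (Module.finrank K V) with h | h
  · exact h
  · exact Submodule.finrank_eq_zero.mp (by omega)

/-- A family of endomorphisms of a finite-dimensional space all of whose sufficiently long products
vanish has vanishing products already from length `finrank K V` on. -/
theorem Module.End.list_prod_eq_zero_of_finrank_le_length {ι K V : Type*} [Field K]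
    [AddCommGroup V] [Module K V] [FiniteDimensional K V] (f : ι → Module.End K V) {N : ℕ}
    (hN : ∀ α : List ι, α.length = N → (α.map f).prod = 0) (α : List ι)
    (hα : Module.finrank K V ≤ α.length) : (α.map f).prod = 0 := by
  let Φ : Submodule K V → Submodule K V := fun S => ⨆ i, S.map (f i)
  have mono : Monotone Φ := fun S T h => iSup_mono fun i => Submodule.map_mono h
  have iterate_eq_bot : ∀ (n : ℕ) (S : Submodule K V),
      (∀ β : List ι, β.length = n → S.map (β.map f).prod = ⊥) → Φ^[n] S = ⊥ := by
    intro n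
    induction n with
    | zero => intro S h; simpa [Module.End.one_eq_id] using h [] rfl
    | succ n ih =>
      intro S h
      rw [Function.iterate_succ_apply]
      refine ih _ fun β hβ => ?_
      rw [Submodule.map_iSup, iSup_eq_bot]
      intro i
      rw [← Submodule.map_comp, ← Module.End.mul_eq_comp]
      simpa using h (β ++ [i]) (by simp [hβ])
  have range_le : ∀ β : List ι, Submodule.map (β.map f).prod ⊤ ≤ Φ^[β.length] ⊤ := by
    intro β
    induction β with
    | nil => simp
    | cons i β ih =>
      rw [List.length_cons, Function.iterate_succ_apply', List.map_cons, List.prod_cons,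
        Module.End.mul_eq_comp, Submodule.map_comp]
      exact (Submodule.map_mono ih).trans (le_iSup (fun j => (Φ^[β.length] ⊤).map (f j)) i)
  have hbot : Φ^[Module.finrank K V] ⊤ = ⊥ :=
    Submodule.iterate_finrank_top_eq_bot mono
      (iterate_eq_bot N ⊤ fun β hβ => by rw [hN β hβ, Submodule.map_zero])
  have hle : Φ^[α.length] ⊤ ≤ Φ^[Module.finrank K V] ⊤ :=
    mono.antitone_iterate_of_map_le le_top hα
  rw [← LinearMap.range_eq_bot, ← Submodule.map_top, ← le_bot_iff, ← hbot]
  exact (range_le α).trans hle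

/-- A convexotonic tuple that is jointly nilpotent has order of nilpotence at most `g`:
`Ξ^α = 0` for every word `α` with `|α| ≥ g`. -/
theorem convexotonic_nilpotent_order_le {g : ℕ} (Ξ : Fin g → Matrix (Fin g) (Fin g) ℂ)
    (hΞ : Convexotonic Ξ)
    (hnil : ∃ N : ℕ, ∀ α : List (Fin g), N ≤ α.length → wordProd Ξ α = 0) :
    ∀ α : List (Fin g), g ≤ α.length → wordProd Ξ α = 0 := by
  obtain ⟨N, hN⟩ := hnil
  intro α hα
  have toLin_wordProd : ∀ β : List (Fin g), Matrix.toLinAlgEquiv' (wordProd Ξ β) =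
      (β.map fun i => Matrix.toLinAlgEquiv' (Ξ i)).prod := fun β => by
    rw [wordProd, map_list_prod, List.map_map, Function.comp_def]
  rw [← map_eq_zero_iff _ (Matrix.toLinAlgEquiv' (R := ℂ) (n := Fin g)).injective, toLin_wordProd]
  refine Module.End.list_prod_eq_zero_of_finrank_le_length _ (N := N) (fun β hβ => ?_) α
    (by simpa using hα)
  rw [← toLin_wordProd, hN β hβ.ge, map_zero]
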